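/- Let G be a graph, let 𝓕 be a set of cycles, and let Y be a nonempty subset of V(G) such that every vertex in Y has degree 0 or degree 1 in G. Then ι(G, 𝓕) = ι(G − Y, 𝓕). -/

import Mathlib

open SimpleGraph

/-- The closed neighbourhood `N[D]` of a set `D` of vertices of the graph `G`. -/
def closedNbhd {V : Type*} (G : SimpleGraph V) (D : Set V) : Set V :=
  D ∪ {v | ∃ u ∈ D, G.Adj u v}

/-- `G` contains a copy of `F`, i.e. a subgraph isomorphic to `F`. -/
def HasCopy {W V : Type*} (F : SimpleGraph W) (G : SimpleGraph V) : Prop :=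
  ∃ f : F →g G, Function.Injective f

/-- `D` is an isolating set of `G` with respect to the set of cycles `{C_n : n ∈ S}` :
the graph `G − N[D]` contains no copy of `C_n` for any `n ∈ S`. -/
def IsCycSetIsolating {V : Type*} (S : Set ℕ) (G : SimpleGraph V) (D : Set V) : Prop :=
  ∀ n ∈ S, ¬ HasCopy (cycleGraph n) (G.induce (closedNbhd G D)ᶜ)

/-- The isolation number of `G` with respect to the set of cycles `{C_n : n ∈ S}`. -/
noncomputable def iotaCycSet {V : Type*} (S : Set ℕ) (G : SimpleGraph V) : ℕ :=
  sInf {r | ∃ D : Set V, D.ncard = r ∧ IsCycSetIsolating S G D}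

theorem isCycSetIsolating_iff {V : Type*} {S : Set ℕ} {G : SimpleGraph V} {D : Set V} :
    IsCycSetIsolating S G D ↔ ∀ n ∈ S, ∀ f : cycleGraph n →g G, Function.Injective f →
      ∃ i, f i ∈ closedNbhd G D := by
  refine forall₂_congr fun n _ => ⟨fun h f hf => ?_, fun h ⟨f, hf⟩ => ?_⟩
  · by_contra! hD
    exact h ⟨⟨fun i => ⟨f i, hD i⟩, fun hab => f.map_adj hab⟩,
      fun a b hab => hf (congrArg Subtype.val hab)⟩
  · obtain ⟨i, hi⟩ := h ((Embedding.induce _).toHom.comp f)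
      (Subtype.val_injective.comp hf)
    exact (f i).2 hi

/-- No vertex of a cycle inside `G` has fewer than two neighbours in `G`. -/
theorem not_subsingleton_neighborSet_of_cycle {V : Type*} {G : SimpleGraph V} {n : ℕ}
    (hn : 3 ≤ n) (f : cycleGraph n →g G) (hf : Function.Injective f) (i : Fin n) :
    ¬ (G.neighborSet (f i)).Subsingleton := by
  obtain ⟨m, rfl⟩ := Nat.exists_eq_add_of_le' hn
  intro h
  have hdeg : 1 < ((cycleGraph (m + 3)).neighborFinset i).card := by
    rw [card_neighborFinset_eq_degree, cycleGraph_degree_three_le]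
    norm_num
  obtain ⟨a, ha, b, hb, hab⟩ := Finset.one_lt_card.1 hdeg
  rw [mem_neighborFinset] at ha hb
  exact hab (hf (h (f.map_adj ha) (f.map_adj hb)))

theorem isCycSetIsolating_univ {V : Type*} {S : Set ℕ} (hS : ∀ n ∈ S, 3 ≤ n)
    (G : SimpleGraph V) : IsCycSetIsolating S G Set.univ := by
  refine isCycSetIsolating_iff.2 fun n hn f _ => ?_
  exact ⟨⟨0, by have := hS n hn; omega⟩, Or.inl trivial⟩

theorem iotaCycSet_le_iotaCycSet {V W : Type*} {S : Set ℕ} (hS : ∀ n ∈ S, 3 ≤ n)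
    {G : SimpleGraph V} {H : SimpleGraph W}
    (h : ∀ D, IsCycSetIsolating S H D → ∃ D', D'.ncard ≤ D.ncard ∧ IsCycSetIsolating S G D') :
    iotaCycSet S G ≤ iotaCycSet S H := by
  obtain ⟨D, hD, hiso⟩ := Nat.sInf_mem
    (s := {r | ∃ D : Set W, D.ncard = r ∧ IsCycSetIsolating S H D})
    ⟨_, Set.univ, rfl, isCycSetIsolating_univ hS H⟩
  obtain ⟨D', hle, hiso'⟩ := h D hiso
  calc iotaCycSet S G ≤ D'.ncard := Nat.sInf_le ⟨D', rfl, hiso'⟩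
    _ ≤ D.ncard := hle
    _ = iotaCycSet S H := hD

theorem IsCycSetIsolating.image_val {V : Type*} {G : SimpleGraph V} {S : Set ℕ} {Y : Set V}
    (hS : ∀ n ∈ S, 3 ≤ n) (hY : ∀ y ∈ Y, (G.neighborSet y).Subsingleton)
    {D : Set ↥Yᶜ} (hD : IsCycSetIsolating S (G.induce Yᶜ) D) :
    IsCycSetIsolating S G (Subtype.val '' D) := by
  refine isCycSetIsolating_iff.2 fun n hn f hf => ?_
  have hfY : ∀ i, f i ∈ Yᶜ := fun i hi =>
    not_subsingleton_neighborSet_of_cycle (hS n hn) f hf i (hY _ hi)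
  obtain ⟨i, hi | ⟨u, hu, hui⟩⟩ := isCycSetIsolating_iff.1 hD n hn
    ⟨fun i => ⟨f i, hfY i⟩, fun hab => f.map_adj hab⟩
    fun a b hab => hf (congrArg Subtype.val hab)
  · exact ⟨i, Or.inl ⟨_, hi, rfl⟩⟩
  · exact ⟨i, Or.inr ⟨u, ⟨u, hu, rfl⟩, hui⟩⟩

/-- Every vertex of `D` in `Y` is replaced by its neighbours outside `Y`. -/
theorem IsCycSetIsolating.induce_compl {V : Type*} {G : SimpleGraph V} {S : Set ℕ} {D : Set V}
    (hD : IsCycSetIsolating S G D) (Y : Set V) :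
    IsCycSetIsolating S (G.induce Yᶜ) {v | ↑v ∈ D ∨ ∃ y ∈ D ∩ Y, G.Adj y v} := by
  refine isCycSetIsolating_iff.2 fun n hn f hf => ?_
  obtain ⟨i, hi | ⟨u, hu, hui⟩⟩ := isCycSetIsolating_iff.1 hD n hn
    ((Embedding.induce _).toHom.comp f) (Subtype.val_injective.comp hf)
  · exact ⟨i, Or.inl (Or.inl hi)⟩
  · by_cases huY : u ∈ Y
    · exact ⟨i, Or.inl (Or.inr ⟨u, ⟨hu, huY⟩, hui⟩)⟩
    · exact ⟨i, Or.inr ⟨⟨u, huY⟩, Or.inl hu, hui⟩⟩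

theorem ncard_replace_le {V : Type*} [Finite V] {G : SimpleGraph V} {Y : Set V}
    (hY : ∀ y ∈ Y, (G.neighborSet y).Subsingleton) (D : Set V) :
    {v : ↥Yᶜ | ↑v ∈ D ∨ ∃ y ∈ D ∩ Y, G.Adj y v}.ncard ≤ D.ncard := by
  have hex : ∀ x, ∃ z, (x ∉ Y → z = x) ∧ (x ∈ Y → ∀ v, G.Adj x v → z = v) := by
    intro x
    by_cases hx : x ∈ Y
    · by_cases hne : ∃ v, G.Adj x v
      · obtain ⟨w, hw⟩ := hne
        exact ⟨w, fun h => absurd hx h, fun _ v hv => hY x hx hw hv⟩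
      · exact ⟨x, fun _ => rfl, fun _ v hv => absurd ⟨v, hv⟩ hne⟩
    · exact ⟨x, fun _ => rfl, fun h => absurd h hx⟩
  choose g hg hgY using hex
  rw [← Set.ncard_image_of_injective _ Subtype.val_injective]
  refine le_trans (Set.ncard_le_ncard ?_ (Set.toFinite _)) (Set.ncard_image_le (f := g))
  rintro _ ⟨v, hv | ⟨y, ⟨hyD, hyY⟩, hyv⟩, rfl⟩
  · exact ⟨v, hv, hg v v.2⟩
  · exact ⟨y, hyD, hgY y hyY v hyv⟩

/-- If `G` is a graph, `𝓕 = {C_n : n ∈ S}` is a set of cycles, and `Y` is a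
nonempty set of vertices of `G` each of which has degree 0 or degree 1 in `G`, then
`ι(G, 𝓕) = ι(G − Y, 𝓕)`. -/
theorem isolation_eq_delete_leaves {V : Type*} [Fintype V] (G : SimpleGraph V)
    (S : Set ℕ) (hS : ∀ n ∈ S, 3 ≤ n) (Y : Set V) (hne : Y.Nonempty)
    (hY : ∀ y ∈ Y, (G.neighborSet y).ncard = 0 ∨ (G.neighborSet y).ncard = 1) :
    iotaCycSet S G = iotaCycSet S (G.induce Yᶜ) := by
  have hsub : ∀ y ∈ Y, (G.neighborSet y).Subsingleton := fun y hy =>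
    (Set.ncard_le_one_iff_subsingleton).1 (by rcases hY y hy with h | h <;> omega)
  apply le_antisymm
  · exact iotaCycSet_le_iotaCycSet hS fun D hD =>
      ⟨_, (Set.ncard_image_of_injective D Subtype.val_injective).le, hD.image_val hS hsub⟩
  · exact iotaCycSet_le_iotaCycSet hS fun D hD =>
      ⟨_, ncard_replace_le hsub D, hD.induce_compl Y⟩
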